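/- Assume p01 ≤ p11 and β ∈ [0,1). Then there exists a unique bounded function V : [0,1]^n → ℝ satisfying the Bellman equation V(ω) = max over subsets a ⊆ {1,…,n} with |a| = k of Q(ω, a), where Q(ω, a) = Σ_{i∈a} ω_i + β · Σ_{s ∈ {0,1}^a} (∏_{i∈a} ω_i^{s_i}(1−ω_i)^{1−s_i}) · V(ω^{a,s}); moreover, for every ω ∈ [0,1]^n, any greedy set g for ω achieves this maximum: V(ω) = Q(ω, g). That is, the greedy policy is optimal for the infinite-horizon discounted problem. -/

import Mathlib

open Finset

noncomputable section

/-- The one-step belief update for an unobserved channel. -/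
def tauF (p01 p11 : ℝ) (w : ℝ) : ℝ := w * p11 + (1 - w) * p01

/-- The set of admissible actions: subsets of `Fin n` of cardinality `k`. -/
def actions (n k : ℕ) : Finset (Finset (Fin n)) :=
  (Finset.univ : Finset (Fin n)).powersetCard k

lemma actions_nonempty {n k : ℕ} (hk : k ≤ n) : (actions n k).Nonempty := by
  rw [actions, Finset.powersetCard_nonempty, Finset.card_univ, Fintype.card_fin]
  exact hk

/-- Number of `true` entries in a `{0,1}^k` realization. -/
def countTrue {k : ℕ} (l : Fin k → Bool) : ℕ :=
  (Finset.univ.filter fun i => l i = true).card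

/-- `q(l; u) = ∏ u_i^{l_i} (1-u_i)^{1-l_i}`. -/
def qProb {k : ℕ} (u : Fin k → ℝ) (l : Fin k → Bool) : ℝ :=
  ∏ i : Fin k, if l i then u i else 1 - u i

/-- The top `k` coordinates `(ω_{n-k+1}, …, ω_n)` of a length-`n` vector. -/
def topCoords {n k : ℕ} (hk : k ≤ n) (ω : Fin n → ℝ) : Fin k → ℝ :=
  fun i => ω ⟨n - k + i.val, by omega⟩

/-- The vector `v_l`: `k - m` copies of `p01`, then `τ(ω_1),…,τ(ω_{n-k})`,
then `m` copies of `p11`, where `m` is the number of ones in `l`. -/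
def vl {n : ℕ} (k : ℕ) (p01 p11 : ℝ) (ω : Fin n → ℝ) (m : ℕ) : Fin n → ℝ :=
  fun j =>
    if j.val < k - m then p01
    else if j.val < n - m then tauF p01 p11 (ω ⟨j.val - (k - m), by omega⟩)
    else p11

/-- The greedy-policy value functions `W`, indexed by the number of remaining
steps (`r = 0` corresponds to the terminal time `T`). -/
def Wval (n k : ℕ) (hk : k ≤ n) (p01 p11 β : ℝ) : ℕ → (Fin n → ℝ) → ℝ
  | 0, ω => ∑ i : Fin n, if n - k ≤ i.val then ω i else 0
  | r + 1, ω =>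
      (∑ i : Fin n, if n - k ≤ i.val then ω i else 0) +
        β * ∑ l : Fin k → Bool,
          qProb (topCoords hk ω) l *
            Wval n k hk p01 p11 β r (vl k p01 p11 ω (countTrue l))

/-- The updated information state `ω^{a,s}`. -/
def nextState {n : ℕ} (p01 p11 : ℝ) (ω : Fin n → ℝ) (a : Finset (Fin n))
    (s : {i // i ∈ a} → Bool) : Fin n → ℝ :=
  fun j => if h : j ∈ a then (if s ⟨j, h⟩ then p11 else p01) else tauF p01 p11 (ω j)

/-- The probability of the realization `s` of the selected channels `a`. -/
def obsProb {n : ℕ} (ω : Fin n → ℝ) (a : Finset (Fin n))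
    (s : {i // i ∈ a} → Bool) : ℝ :=
  ∏ i : {i // i ∈ a}, if s i then ω i.val else 1 - ω i.val

/-- The optimal value functions `V`, indexed by the number of remaining steps. -/
def Vval (n k : ℕ) (hk : k ≤ n) (p01 p11 β : ℝ) : ℕ → (Fin n → ℝ) → ℝ
  | 0, ω => (actions n k).sup' (actions_nonempty hk) fun a => ∑ i ∈ a, ω i
  | r + 1, ω =>
      (actions n k).sup' (actions_nonempty hk) fun a =>
        (∑ i ∈ a, ω i) +
          β * ∑ s : {i // i ∈ a} → Bool,
            obsProb ω a s * Vval n k hk p01 p11 β r (nextState p01 p11 ω a s)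

/-- `Q_t(ω, a)`: the value of taking action `a` now and acting optimally
afterwards, indexed by the number of remaining steps. -/
def Qval (n k : ℕ) (hk : k ≤ n) (p01 p11 β : ℝ) : ℕ → (Fin n → ℝ) → Finset (Fin n) → ℝ
  | 0, ω, a => ∑ i ∈ a, ω i
  | r + 1, ω, a =>
      (∑ i ∈ a, ω i) +
        β * ∑ s : {i // i ∈ a} → Bool,
          obsProb ω a s * Vval n k hk p01 p11 β r (nextState p01 p11 ω a s)

/-- Replace the coordinates in positions `j` and `j+1` (`0`-indexed) by `x` and `y`. -/
def upd2 {n : ℕ} (ω : Fin n → ℝ) (j : ℕ) (hj : j + 1 < n) (x y : ℝ) : Fin n → ℝ :=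
  Function.update (Function.update ω ⟨j, by omega⟩ x) ⟨j + 1, hj⟩ y

/-- The cyclic shift `(ω_2, …, ω_n, ω_1)`. -/
def cyc {n : ℕ} (hn : 0 < n) (ω : Fin n → ℝ) : Fin n → ℝ :=
  fun j => ω ⟨(j.val + 1) % n, Nat.mod_lt _ hn⟩

end

/-- Mean of `F (number of successes) (number of failures)` over independent Bernoulli trials
whose success probabilities are listed in the argument. -/
def outcomeMean : (ℕ → ℕ → ℝ) → List ℝ → ℝ
  | F, [] => F 0 0
  | F, x :: v =>
      x * outcomeMean (fun b a => F (b + 1) a) v + (1 - x) * outcomeMean (fun b a => F b (a + 1)) v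

/-- Value over `r` steps of the policy that plays the first `k` channels of a priority list, then
moves the successes to the front and the failures to the back. -/
def priorityValue (k : ℕ) (p01 p11 β : ℝ) : ℕ → List ℝ → ℝ
  | 0, _ => 0
  | r + 1, L =>
      (L.take k).sum + β * outcomeMean (fun b a => priorityValue k p01 p11 β r
        (List.replicate b p11 ++ ((L.drop k).map (tauF p01 p11) ++ List.replicate a p01)))
        (L.take k)

lemma outcomeMean_perm {v v' : List ℝ} (h : v.Perm v') (F : ℕ → ℕ → ℝ) :
    outcomeMean F v = outcomeMean F v' := by
  induction h generalizing F with
  | nil => rfl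
  | cons x _ ih => simp only [outcomeMean, ih]
  | swap x y l => simp only [outcomeMean]; ring
  | trans _ _ ih₁ ih₂ => rw [ih₁, ih₂]

lemma outcomeMean_mono {v : List ℝ} (hv : ∀ x ∈ v, x ∈ Set.Icc (0 : ℝ) 1) {F G : ℕ → ℕ → ℝ}
    (h : ∀ b a, F b a ≤ G b a) : outcomeMean F v ≤ outcomeMean G v := by
  induction v generalizing F G with
  | nil => exact h 0 0
  | cons x v ih =>
    obtain ⟨hx, hv⟩ := List.forall_mem_cons.1 hv
    exact add_le_add (mul_le_mul_of_nonneg_left (ih hv fun _ _ => h _ _) hx.1)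
      (mul_le_mul_of_nonneg_left (ih hv fun _ _ => h _ _) (by linarith [hx.2]))

lemma outcomeMean_linear (s t : ℝ) (F G : ℕ → ℕ → ℝ) (v : List ℝ) :
    outcomeMean (fun b a => s * F b a + t * G b a) v =
      s * outcomeMean F v + t * outcomeMean G v := by
  induction v generalizing F G with
  | nil => rfl
  | cons x v ih =>
    simp only [outcomeMean]
    rw [ih (fun b a => F (b + 1) a) (fun b a => G (b + 1) a),
      ih (fun b a => F b (a + 1)) (fun b a => G b (a + 1))]
    ring

lemma outcomeMean_const (c : ℝ) (v : List ℝ) : outcomeMean (fun _ _ => c) v = c := by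
  induction v with
  | nil => rfl
  | cons x v ih => simp only [outcomeMean, ih]; ring

lemma outcomeMean_le_add {v : List ℝ} (hv : ∀ x ∈ v, x ∈ Set.Icc (0 : ℝ) 1) {F G : ℕ → ℕ → ℝ}
    (c : ℝ) (h : ∀ b a, F b a ≤ c + G b a) : outcomeMean F v ≤ c + outcomeMean G v := by
  have hlin := outcomeMean_linear 1 1 (fun _ _ => c) G v
  simp only [one_mul, outcomeMean_const] at hlin
  exact hlin ▸ outcomeMean_mono hv h

lemma tauF_mem_Icc {p01 p11 w : ℝ} (hord : p01 ≤ p11) (hw : w ∈ Set.Icc (0 : ℝ) 1) :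
    tauF p01 p11 w ∈ Set.Icc p01 p11 := by
  obtain ⟨h0, h1⟩ := hw
  constructor <;> unfold tauF <;> nlinarith

lemma tauF_mono {p01 p11 : ℝ} (hord : p01 ≤ p11) : Monotone (tauF p01 p11) := by
  intro x y h
  unfold tauF
  nlinarith

section PriorityValue

variable {k : ℕ} {p01 p11 β : ℝ}

lemma priorityValue_succ_append {R : List ℝ} (hR : R.length = k) (r : ℕ) (L : List ℝ) :
    priorityValue k p01 p11 β (r + 1) (R ++ L) =
      R.sum + β * outcomeMean (fun b a => priorityValue k p01 p11 β r
        (List.replicate b p11 ++ (L.map (tauF p01 p11) ++ List.replicate a p01))) R := by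
  simp [priorityValue, ← hR]

lemma priorityValue_perm_append {R R' : List ℝ} (h : R.Perm R') (hR : R.length ≤ k) (r : ℕ)
    (L : List ℝ) :
    priorityValue k p01 p11 β r (R ++ L) = priorityValue k p01 p11 β r (R' ++ L) := by
  cases r with
  | zero => rfl
  | succ r =>
    have hp : (R ++ L.take (k - R.length)).Perm (R' ++ L.take (k - R.length)) :=
      h.append_right _
    have hR' : R'.length ≤ k := h.length_eq ▸ hR
    simp only [priorityValue, List.take_append, List.drop_append, List.take_of_length_le hR,
      List.take_of_length_le hR', List.drop_of_length_le hR, List.drop_of_length_le hR',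
      ← h.length_eq, hp.sum_eq, outcomeMean_perm hp]

/-- The value is affine in every coordinate. -/
lemma priorityValue_affine (r : ℕ) (R L : List ℝ) (t u v : ℝ) :
    priorityValue k p01 p11 β r (R ++ (t * u + (1 - t) * v) :: L) =
      t * priorityValue k p01 p11 β r (R ++ u :: L) +
        (1 - t) * priorityValue k p01 p11 β r (R ++ v :: L) := by
  induction r generalizing R L u v with
  | zero => simp [priorityValue]
  | succ r ih =>
    rcases le_or_gt k R.length with hk | hk
    · have hτ : tauF p01 p11 (t * u + (1 - t) * v) =
          t * tauF p01 p11 u + (1 - t) * tauF p01 p11 v := by unfold tauF; ring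
      simp only [priorityValue, List.take_append_of_le_length hk,
        List.drop_append_of_le_length hk, List.map_append, List.map_cons, hτ]
      simp only [List.append_assoc, List.cons_append]
      simp only [← List.append_assoc (List.replicate _ p11), ih]
      rw [outcomeMean_linear]
      ring
    · obtain ⟨m, rfl⟩ : ∃ m, k = R.length + (m + 1) := ⟨k - R.length - 1, by omega⟩
      have hexp : ∀ w (S : List ℝ) (F : ℕ → ℕ → ℝ), outcomeMean F (R ++ w :: S) =
          w * outcomeMean (fun b a => F (b + 1) a) (R ++ S) +
            (1 - w) * outcomeMean (fun b a => F b (a + 1)) (R ++ S) := fun w S F =>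
        outcomeMean_perm List.perm_middle F
      simp only [priorityValue, List.take_length_add_append, List.drop_length_add_append,
        List.take_succ_cons, List.drop_succ_cons, List.sum_append, List.sum_cons, hexp]
      ring

/-- Every coordinate can be replaced by its Bernoulli outcome. -/
lemma priorityValue_eq_vertices (r : ℕ) (R L : List ℝ) (x : ℝ) :
    priorityValue k p01 p11 β r (R ++ x :: L) =
      x * priorityValue k p01 p11 β r (R ++ 1 :: L) +
        (1 - x) * priorityValue k p01 p11 β r (R ++ 0 :: L) := by
  simpa using priorityValue_affine (k := k) (p01 := p01) (p11 := p11) (β := β) r R L x 1 0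

/-- Adjacent channels are better ordered by decreasing belief. -/
def SwapImproves (k : ℕ) (p01 p11 β : ℝ) (r : ℕ) : Prop :=
  ∀ (R L : List ℝ) (x y : ℝ), (∀ z ∈ R, z ∈ Set.Icc (0 : ℝ) 1) →
    (∀ z ∈ L, z ∈ Set.Icc (0 : ℝ) 1) → x ∈ Set.Icc (0 : ℝ) 1 → y ∈ Set.Icc (0 : ℝ) 1 → y ≤ x →
    priorityValue k p01 p11 β r (R ++ y :: x :: L) ≤ priorityValue k p01 p11 β r (R ++ x :: y :: L)

/-- Moving the last channel to the front costs at most one unit. -/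
def RotationBound (k : ℕ) (p01 p11 β : ℝ) (r : ℕ) : Prop :=
  ∀ (L : List ℝ) (x : ℝ), (∀ z ∈ L, z ∈ Set.Icc (0 : ℝ) 1) → x ∈ Set.Icc (0 : ℝ) 1 →
    priorityValue k p01 p11 β r (L ++ [x]) ≤ 1 + priorityValue k p01 p11 β r (x :: L)

lemma SwapImproves.move_large {r : ℕ} (h : SwapImproves k p01 p11 β r) {R M L : List ℝ} {x : ℝ}
    (hR : ∀ z ∈ R, z ∈ Set.Icc (0 : ℝ) 1) (hM : ∀ z ∈ M, z ∈ Set.Icc (0 : ℝ) 1)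
    (hL : ∀ z ∈ L, z ∈ Set.Icc (0 : ℝ) 1) (hx : x ∈ Set.Icc (0 : ℝ) 1) (hMx : ∀ z ∈ M, z ≤ x) :
    priorityValue k p01 p11 β r (R ++ (M ++ x :: L)) ≤
      priorityValue k p01 p11 β r (R ++ x :: (M ++ L)) := by
  induction M generalizing R with
  | nil => rfl
  | cons y M ih =>
    obtain ⟨hy, hM⟩ := List.forall_mem_cons.1 hM
    obtain ⟨hyx, hMx⟩ := List.forall_mem_cons.1 hMx
    refine le_trans ?_ (h R (M ++ L) x y hR (List.forall_mem_append.2 ⟨hM, hL⟩) hx hy hyx)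
    simpa using ih (R := R ++ [y])
      (List.forall_mem_append.2 ⟨hR, List.forall_mem_singleton.2 hy⟩) hM hMx

lemma SwapImproves.move_small {r : ℕ} (h : SwapImproves k p01 p11 β r) {R M L : List ℝ} {x : ℝ}
    (hR : ∀ z ∈ R, z ∈ Set.Icc (0 : ℝ) 1) (hM : ∀ z ∈ M, z ∈ Set.Icc (0 : ℝ) 1)
    (hL : ∀ z ∈ L, z ∈ Set.Icc (0 : ℝ) 1) (hx : x ∈ Set.Icc (0 : ℝ) 1) (hMx : ∀ z ∈ M, x ≤ z) :
    priorityValue k p01 p11 β r (R ++ x :: (M ++ L)) ≤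
      priorityValue k p01 p11 β r (R ++ (M ++ x :: L)) := by
  induction M generalizing R with
  | nil => rfl
  | cons y M ih =>
    obtain ⟨hy, hM⟩ := List.forall_mem_cons.1 hM
    obtain ⟨hyx, hMx⟩ := List.forall_mem_cons.1 hMx
    refine le_trans (h R (M ++ L) y x hR (List.forall_mem_append.2 ⟨hM, hL⟩) hy hx hyx) ?_
    simpa using ih (R := R ++ [y])
      (List.forall_mem_append.2 ⟨hR, List.forall_mem_singleton.2 hy⟩) hM hMx

lemma SwapImproves.insertionSort {r : ℕ} (h : SwapImproves k p01 p11 β r) {R L : List ℝ}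
    (hR : ∀ z ∈ R, z ∈ Set.Icc (0 : ℝ) 1) (hL : ∀ z ∈ L, z ∈ Set.Icc (0 : ℝ) 1) :
    priorityValue k p01 p11 β r (R ++ L) ≤
      priorityValue k p01 p11 β r (R ++ L.insertionSort (· ≥ ·)) := by
  have hins : ∀ (M R : List ℝ) (x : ℝ), (∀ z ∈ R, z ∈ Set.Icc (0 : ℝ) 1) →
      (∀ z ∈ M, z ∈ Set.Icc (0 : ℝ) 1) → x ∈ Set.Icc (0 : ℝ) 1 →
      priorityValue k p01 p11 β r (R ++ x :: M) ≤
        priorityValue k p01 p11 β r (R ++ M.orderedInsert (· ≥ ·) x) := by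
    intro M
    induction M with
    | nil => exact fun _ _ _ _ _ => le_rfl
    | cons y M ih =>
      intro R x hR hM hx
      obtain ⟨hy, hM⟩ := List.forall_mem_cons.1 hM
      rw [List.orderedInsert_cons]
      split_ifs with hxy
      · exact le_rfl
      · refine (h R M y x hR hM hy hx (not_le.1 hxy).le).trans ?_
        simpa using ih (R ++ [y]) x
          (List.forall_mem_append.2 ⟨hR, List.forall_mem_singleton.2 hy⟩) hM hx
  induction L generalizing R with
  | nil => exact le_rfl
  | cons x L ih =>
    obtain ⟨hx, hL⟩ := List.forall_mem_cons.1 hL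
    have h1 := ih (R := R ++ [x])
      (List.forall_mem_append.2 ⟨hR, List.forall_mem_singleton.2 hx⟩) hL
    simp only [List.append_assoc, List.singleton_append] at h1
    exact h1.trans (hins _ R x hR (fun z hz => hL z ((List.mem_insertionSort _).1 hz)) hx)

lemma SwapImproves.move_last_forward {r : ℕ} (hS : SwapImproves k p01 p11 β r)
    (hB : RotationBound k p01 p11 β r) {P M : List ℝ} {y : ℝ}
    (hP : ∀ z ∈ P, z ∈ Set.Icc (0 : ℝ) 1) (hM : ∀ z ∈ M, z ∈ Set.Icc (0 : ℝ) 1)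
    (hy : y ∈ Set.Icc (0 : ℝ) 1) (hPy : ∀ z ∈ P, y ≤ z) :
    priorityValue k p01 p11 β r (P ++ (M ++ [y])) ≤
      1 + priorityValue k p01 p11 β r (P ++ y :: M) := by
  have h1 := hB (P ++ M) y (List.forall_mem_append.2 ⟨hP, hM⟩) hy
  have h2 := hS.move_small (R := []) (by simp) hP hM hy hPy
  simp only [List.append_assoc, List.nil_append] at h1 h2
  linarith

lemma priorityValue_succ_of_length {R : List ℝ} (hR : R.length + 1 = k) (r : ℕ) (x : ℝ)
    (L : List ℝ) :
    priorityValue k p01 p11 β (r + 1) (R ++ x :: L) =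
      R.sum + x + β * (x * outcomeMean (fun b a => priorityValue k p01 p11 β r
          (List.replicate (b + 1) p11 ++ (L.map (tauF p01 p11) ++ List.replicate a p01))) R +
        (1 - x) * outcomeMean (fun b a => priorityValue k p01 p11 β r
          (List.replicate b p11 ++ (L.map (tauF p01 p11) ++ List.replicate (a + 1) p01))) R) := by
  have h := priorityValue_succ_append (p01 := p01) (p11 := p11) (β := β) (R := R ++ [x])
    (by simpa using hR) r L
  rw [List.append_assoc, List.singleton_append] at h
  rw [h, outcomeMean_perm (List.perm_append_singleton x R)]
  simp [outcomeMean]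

lemma mem_Icc_of_mem_replicate {p z : ℝ} {m : ℕ} (hp : p ∈ Set.Icc (0 : ℝ) 1)
    (hz : z ∈ List.replicate m p) : z ∈ Set.Icc (0 : ℝ) 1 :=
  List.eq_of_mem_replicate hz ▸ hp

lemma mem_Icc_of_mem_map_tauF (hp01 : p01 ∈ Set.Icc (0 : ℝ) 1) (hp11 : p11 ∈ Set.Icc (0 : ℝ) 1)
    (hord : p01 ≤ p11) {L : List ℝ} (hL : ∀ z ∈ L, z ∈ Set.Icc (0 : ℝ) 1) {z : ℝ}
    (hz : z ∈ L.map (tauF p01 p11)) : z ∈ Set.Icc p01 p11 ∧ z ∈ Set.Icc (0 : ℝ) 1 := by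
  obtain ⟨w, hw, rfl⟩ := List.mem_map.1 hz
  have h := tauF_mem_Icc hord (hL w hw)
  exact ⟨h, hp01.1.trans h.1, h.2.trans hp11.2⟩

lemma mul_outcomeMean_mono (hβ0 : 0 ≤ β) {v : List ℝ} (hv : ∀ x ∈ v, x ∈ Set.Icc (0 : ℝ) 1)
    {F G : ℕ → ℕ → ℝ} (h : ∀ b a, F b a ≤ G b a) :
    β * outcomeMean F v ≤ β * outcomeMean G v :=
  mul_le_mul_of_nonneg_left (outcomeMean_mono hv h) hβ0

lemma mul_outcomeMean_le_one_add (hβ0 : 0 ≤ β) (hβ1 : β ≤ 1) {v : List ℝ}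
    (hv : ∀ x ∈ v, x ∈ Set.Icc (0 : ℝ) 1) {F G : ℕ → ℕ → ℝ} (h : ∀ b a, F b a ≤ 1 + G b a) :
    β * outcomeMean F v ≤ 1 + β * outcomeMean G v := by
  have := mul_le_mul_of_nonneg_left (outcomeMean_le_add hv 1 h) hβ0
  linarith

lemma SwapImproves.succ (hp01 : p01 ∈ Set.Icc (0 : ℝ) 1) (hp11 : p11 ∈ Set.Icc (0 : ℝ) 1)
    (hord : p01 ≤ p11) (hβ0 : 0 ≤ β) (hβ1 : β ≤ 1) {r : ℕ} (hS : SwapImproves k p01 p11 β r)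
    (hB : RotationBound k p01 p11 β r) : SwapImproves k p01 p11 β (r + 1) := by
  intro R L x y hR hL hx hy hyx
  rcases lt_trichotomy (R.length + 1) k with hk | hk | hk
  · have hperm : (R ++ [y, x]).Perm (R ++ [x, y]) := (List.Perm.swap x y []).append_left R
    have := priorityValue_perm_append (k := k) (p01 := p01) (p11 := p11) (β := β)
      hperm (by rw [List.length_append]; exact hk) (r + 1) L
    simp only [List.append_assoc, List.cons_append, List.nil_append] at this
    exact this.le
  · have hexp : ∀ u v : ℝ, priorityValue k p01 p11 β (r + 1) (R ++ u :: v :: L) =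
        u * (v * priorityValue k p01 p11 β (r + 1) (R ++ 1 :: 1 :: L) +
          (1 - v) * priorityValue k p01 p11 β (r + 1) (R ++ 1 :: 0 :: L)) +
        (1 - u) * (v * priorityValue k p01 p11 β (r + 1) (R ++ 0 :: 1 :: L) +
          (1 - v) * priorityValue k p01 p11 β (r + 1) (R ++ 0 :: 0 :: L)) := by
      intro u v
      have h1 := priorityValue_eq_vertices (k := k) (p01 := p01) (p11 := p11) (β := β) (r + 1)
        (R ++ [1]) L v
      have h0 := priorityValue_eq_vertices (k := k) (p01 := p01) (p11 := p11) (β := β) (r + 1)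
        (R ++ [0]) L v
      simp only [List.append_assoc, List.singleton_append] at h1 h0
      rw [priorityValue_eq_vertices, h1, h0]
    have hvert : priorityValue k p01 p11 β (r + 1) (R ++ 0 :: 1 :: L) ≤
        priorityValue k p01 p11 β (r + 1) (R ++ 1 :: 0 :: L) := by
      rw [priorityValue_succ_of_length hk, priorityValue_succ_of_length hk]
      have := mul_outcomeMean_le_one_add hβ0 hβ1 hR
        (F := fun b a => priorityValue k p01 p11 β r (List.replicate b p11 ++
          ((1 :: L).map (tauF p01 p11) ++ List.replicate (a + 1) p01)))
        (G := fun b a => priorityValue k p01 p11 β r (List.replicate (b + 1) p11 ++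
          ((0 :: L).map (tauF p01 p11) ++ List.replicate a p01))) (by
          intro b a
          have := hS.move_last_forward hB (P := List.replicate (b + 1) p11)
            (M := L.map (tauF p01 p11) ++ List.replicate a p01) (y := p01)
            (fun z => mem_Icc_of_mem_replicate hp11)
            (List.forall_mem_append.2
              ⟨fun z hz => (mem_Icc_of_mem_map_tauF hp01 hp11 hord hL hz).2,
                fun z => mem_Icc_of_mem_replicate hp01⟩)
            hp01 (fun z hz => List.eq_of_mem_replicate hz ▸ hord)
          simpa [tauF, List.replicate_succ', List.append_assoc] using this)
      linarith
    rw [hexp x y, hexp y x]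
    nlinarith
  · have hk' : k ≤ R.length := by omega
    have hlen : (R.take k).length = k := by simpa using hk'
    rw [← List.take_append_drop k R, List.append_assoc, List.append_assoc,
      priorityValue_succ_append hlen, priorityValue_succ_append hlen]
    refine (add_le_add_iff_left _).2 (mul_outcomeMean_mono hβ0
      (fun z hz => hR z (List.mem_of_mem_take hz)) fun b a => ?_)
    have hD : ∀ z ∈ R.drop k, z ∈ Set.Icc (0 : ℝ) 1 := fun z hz => hR z (List.mem_of_mem_drop hz)
    have hτ : ∀ w ∈ Set.Icc (0 : ℝ) 1, tauF p01 p11 w ∈ Set.Icc (0 : ℝ) 1 := fun w hw =>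
      ⟨hp01.1.trans (tauF_mem_Icc hord hw).1, (tauF_mem_Icc hord hw).2.trans hp11.2⟩
    have := hS (List.replicate b p11 ++ (R.drop k).map (tauF p01 p11))
      (L.map (tauF p01 p11) ++ List.replicate a p01) (tauF p01 p11 x) (tauF p01 p11 y)
      (List.forall_mem_append.2 ⟨fun z => mem_Icc_of_mem_replicate hp11,
        fun z hz => (mem_Icc_of_mem_map_tauF hp01 hp11 hord hD hz).2⟩)
      (List.forall_mem_append.2 ⟨fun z hz => (mem_Icc_of_mem_map_tauF hp01 hp11 hord hL hz).2,
        fun z => mem_Icc_of_mem_replicate hp01⟩)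
      (hτ x hx) (hτ y hy) (tauF_mono hord hyx)
    simpa using this

lemma RotationBound.succ (hk1 : 1 ≤ k) (hp01 : p01 ∈ Set.Icc (0 : ℝ) 1)
    (hp11 : p11 ∈ Set.Icc (0 : ℝ) 1) (hord : p01 ≤ p11) (hβ0 : 0 ≤ β) (hβ1 : β ≤ 1) {r : ℕ}
    (hS : SwapImproves k p01 p11 β r) (hB : RotationBound k p01 p11 β r) :
    RotationBound k p01 p11 β (r + 1) := by
  intro L x hL hx
  rcases lt_or_ge L.length k with hk | hk
  · have := priorityValue_perm_append (p01 := p01) (p11 := p11) (β := β)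
      (List.perm_append_singleton x L) (by simpa using hk) (r + 1) []
    simp only [List.append_nil] at this
    linarith
  obtain ⟨R, y, L, rfl, hR⟩ : ∃ (R : List ℝ) (y : ℝ) (L' : List ℝ),
      L = R ++ y :: L' ∧ R.length + 1 = k := by
    refine ⟨L.take (k - 1), L[k - 1], L.drop (k - 1 + 1), ?_, ?_⟩
    · rw [← List.drop_eq_getElem_cons, List.take_append_drop]
    · rw [List.length_take]; omega
  obtain ⟨hRI, hL⟩ := List.forall_mem_append.1 hL
  obtain ⟨hy, hL⟩ := List.forall_mem_cons.1 hL
  have hLτ : ∀ z ∈ L.map (tauF p01 p11), z ∈ Set.Icc p01 p11 ∧ z ∈ Set.Icc (0 : ℝ) 1 :=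
    fun z hz => mem_Icc_of_mem_map_tauF hp01 hp11 hord hL hz
  have hrep1 : ∀ m, ∀ z ∈ List.replicate m p11, z ∈ Set.Icc (0 : ℝ) 1 :=
    fun m z => mem_Icc_of_mem_replicate hp11
  have hrep0 : ∀ m, ∀ z ∈ List.replicate m p01, z ∈ Set.Icc (0 : ℝ) 1 :=
    fun m z => mem_Icc_of_mem_replicate hp01
  have hfront : ∀ b a, priorityValue k p01 p11 β r (List.replicate b p11 ++
      (L.map (tauF p01 p11) ++ p11 :: List.replicate a p01)) ≤
      priorityValue k p01 p11 β r (List.replicate b p11 ++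
        p11 :: (L.map (tauF p01 p11) ++ List.replicate a p01)) := fun b a =>
    hS.move_large (hrep1 b) (fun z hz => (hLτ z hz).2) (hrep0 a) hp11 fun z hz => (hLτ z hz).1.2
  have hback : ∀ b a, priorityValue k p01 p11 β r (List.replicate b p11 ++
      (L.map (tauF p01 p11) ++ List.replicate (a + 1) p01)) ≤
      1 + priorityValue k p01 p11 β r (List.replicate b p11 ++
        p01 :: (L.map (tauF p01 p11) ++ List.replicate a p01)) := by
    intro b a
    have := hS.move_last_forward hB (hrep1 b)
      (List.forall_mem_append.2 ⟨fun z hz => (hLτ z hz).2, hrep0 a⟩) hp01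
      (fun z hz => List.eq_of_mem_replicate hz ▸ hord)
    simpa [List.replicate_succ', List.append_assoc] using this
  have h11 : priorityValue k p01 p11 β (r + 1) (R ++ 1 :: (L ++ [1])) ≤
      1 + priorityValue k p01 p11 β (r + 1) (R ++ 1 :: 1 :: L) := by
    rw [priorityValue_succ_of_length hR, priorityValue_succ_of_length hR]
    have := mul_outcomeMean_mono hβ0 hRI fun b a => hfront (b + 1) a
    simp [tauF] at this ⊢
    linarith
  have h00 : priorityValue k p01 p11 β (r + 1) (R ++ 0 :: (L ++ [0])) ≤
      1 + priorityValue k p01 p11 β (r + 1) (R ++ 0 :: 0 :: L) := by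
    rw [priorityValue_succ_of_length hR, priorityValue_succ_of_length hR]
    have := mul_outcomeMean_le_one_add hβ0 hβ1 hRI fun b a => hback b (a + 1)
    simp [tauF, List.replicate_succ] at this ⊢
    linarith
  have h01 : priorityValue k p01 p11 β (r + 1) (R ++ 0 :: (L ++ [1])) ≤
      1 + priorityValue k p01 p11 β (r + 1) (R ++ 1 :: 0 :: L) := by
    rw [priorityValue_succ_of_length hR, priorityValue_succ_of_length hR]
    have h1 := mul_outcomeMean_mono hβ0 hRI fun b a => hfront b (a + 1)
    have h2 := mul_outcomeMean_le_one_add hβ0 hβ1 hRI fun b a => hback (b + 1) a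
    simp [tauF, List.replicate_succ'] at h1 h2 ⊢
    linarith
  have h10 : priorityValue k p01 p11 β (r + 1) (R ++ 1 :: (L ++ [0])) ≤
      1 + priorityValue k p01 p11 β (r + 1) (R ++ 0 :: 1 :: L) := by
    rw [priorityValue_succ_of_length hR, priorityValue_succ_of_length hR]
    have e1 : ∀ b (X : List ℝ), List.replicate (b + 1) p11 ++ X =
        List.replicate b p11 ++ p11 :: X := by simp [List.replicate_succ']
    have e0 : ∀ a, List.replicate (a + 1) p01 = p01 :: List.replicate a p01 :=
      fun _ => List.replicate_succ
    simp only [List.map_append, List.map_cons, List.map_nil, tauF, e1, e0]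
    simp
    linarith
  have hperm : priorityValue k p01 p11 β (r + 1) (x :: (R ++ y :: L)) =
      priorityValue k p01 p11 β (r + 1) (R ++ x :: y :: L) := by
    have := priorityValue_perm_append (p01 := p01) (p11 := p11) (β := β)
      (List.perm_append_singleton x R) (by simpa using hR.le) (r + 1) (y :: L)
    simpa using this.symm
  have hxy : ∀ c : ℝ, priorityValue k p01 p11 β (r + 1) (R ++ c :: y :: L) =
      y * priorityValue k p01 p11 β (r + 1) (R ++ c :: 1 :: L) +
        (1 - y) * priorityValue k p01 p11 β (r + 1) (R ++ c :: 0 :: L) := by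
    intro c
    simpa using priorityValue_eq_vertices (k := k) (p01 := p01) (p11 := p11) (β := β) (r + 1)
      (R ++ [c]) L y
  have hyx : ∀ c : ℝ, priorityValue k p01 p11 β (r + 1) (R ++ c :: (L ++ [x])) =
      x * priorityValue k p01 p11 β (r + 1) (R ++ c :: (L ++ [1])) +
        (1 - x) * priorityValue k p01 p11 β (r + 1) (R ++ c :: (L ++ [0])) := by
    intro c
    simpa using priorityValue_eq_vertices (k := k) (p01 := p01) (p11 := p11) (β := β) (r + 1)
      (R ++ c :: L) [] x
  rw [hperm, List.append_assoc, List.cons_append, priorityValue_eq_vertices, hyx 1, hyx 0,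
    priorityValue_eq_vertices _ R (y :: L), hxy 1, hxy 0]
  have hx' : 0 ≤ 1 - x := by linarith [hx.2]
  have hy' : 0 ≤ 1 - y := by linarith [hy.2]
  have e11 := mul_le_mul_of_nonneg_left h11 (mul_nonneg hx.1 hy.1)
  have e01 := mul_le_mul_of_nonneg_left h01 (mul_nonneg hx.1 hy')
  have e10 := mul_le_mul_of_nonneg_left h10 (mul_nonneg hx' hy.1)
  have e00 := mul_le_mul_of_nonneg_left h00 (mul_nonneg hx' hy')
  linarith

lemma swapImproves_and_rotationBound (hk1 : 1 ≤ k) (hp01 : p01 ∈ Set.Icc (0 : ℝ) 1)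
    (hp11 : p11 ∈ Set.Icc (0 : ℝ) 1) (hord : p01 ≤ p11) (hβ0 : 0 ≤ β) (hβ1 : β ≤ 1) (r : ℕ) :
    SwapImproves k p01 p11 β r ∧ RotationBound k p01 p11 β r := by
  induction r with
  | zero => exact ⟨fun _ _ _ _ _ _ _ _ _ => le_rfl, fun _ _ _ _ => by simp [priorityValue]⟩
  | succ r ih =>
    exact ⟨ih.1.succ hp01 hp11 hord hβ0 hβ1 ih.2,
      ih.2.succ hk1 hp01 hp11 hord hβ0 hβ1 ih.1⟩

lemma mem_Icc_of_mem_next (hp01 : p01 ∈ Set.Icc (0 : ℝ) 1) (hp11 : p11 ∈ Set.Icc (0 : ℝ) 1)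
    (hord : p01 ≤ p11) {L : List ℝ} (hL : ∀ z ∈ L, z ∈ Set.Icc (0 : ℝ) 1) (b a : ℕ) :
    ∀ z ∈ List.replicate b p11 ++ (L.map (tauF p01 p11) ++ List.replicate a p01),
      z ∈ Set.Icc (0 : ℝ) 1 :=
  List.forall_mem_append.2 ⟨fun _ => mem_Icc_of_mem_replicate hp11, List.forall_mem_append.2
    ⟨fun _ hz => (mem_Icc_of_mem_map_tauF hp01 hp11 hord hL hz).2,
      fun _ => mem_Icc_of_mem_replicate hp01⟩⟩

lemma priorityValue_le_succ (hp01 : p01 ∈ Set.Icc (0 : ℝ) 1) (hp11 : p11 ∈ Set.Icc (0 : ℝ) 1)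
    (hord : p01 ≤ p11) (hβ0 : 0 ≤ β) (r : ℕ) {L : List ℝ}
    (hL : ∀ z ∈ L, z ∈ Set.Icc (0 : ℝ) 1) :
    priorityValue k p01 p11 β r L ≤ priorityValue k p01 p11 β (r + 1) L := by
  have hT : ∀ z ∈ L.take k, z ∈ Set.Icc (0 : ℝ) 1 := fun z hz => hL z (List.mem_of_mem_take hz)
  induction r generalizing L with
  | zero =>
    simpa [priorityValue, outcomeMean_const] using List.sum_nonneg fun z hz => (hT z hz).1
  | succ r ih =>
    refine (add_le_add_iff_left _).2 (mul_outcomeMean_mono hβ0 hT fun b a => ?_)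
    have hnext := mem_Icc_of_mem_next hp01 hp11 hord
      (fun z (hz : z ∈ L.drop k) => hL z (List.mem_of_mem_drop hz)) b a
    exact ih hnext fun z hz => hnext z (List.mem_of_mem_take hz)

lemma priorityValue_le (hp01 : p01 ∈ Set.Icc (0 : ℝ) 1) (hp11 : p11 ∈ Set.Icc (0 : ℝ) 1)
    (hord : p01 ≤ p11) (hβ0 : 0 ≤ β) (hβ1 : β < 1) (r : ℕ) {L : List ℝ}
    (hL : ∀ z ∈ L, z ∈ Set.Icc (0 : ℝ) 1) :
    priorityValue k p01 p11 β r L ≤ k / (1 - β) := by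
  have hβ : 0 < 1 - β := by linarith
  induction r generalizing L with
  | zero => exact div_nonneg k.cast_nonneg hβ.le
  | succ r ih =>
    have hT : ∀ z ∈ L.take k, z ∈ Set.Icc (0 : ℝ) 1 := fun z hz => hL z (List.mem_of_mem_take hz)
    have hsum : (L.take k).sum ≤ k := by
      have h := List.sum_le_card_nsmul (L.take k) 1 fun z hz => (hT z hz).2
      rw [nsmul_one] at h
      exact h.trans (Nat.cast_le.2 (List.length_take_le k L))
    have hmean := mul_outcomeMean_mono hβ0 hT
      (F := fun b a => priorityValue k p01 p11 β r (List.replicate b p11 ++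
        ((L.drop k).map (tauF p01 p11) ++ List.replicate a p01)))
      (G := fun _ _ => k / (1 - β)) fun b a => ih (mem_Icc_of_mem_next hp01 hp11 hord
        (fun z hz => hL z (List.mem_of_mem_drop hz)) b a)
    rw [outcomeMean_const] at hmean
    calc _ ≤ (k : ℝ) + β * (k / (1 - β)) := add_le_add hsum hmean
      _ = k / (1 - β) := by field_simp; ring

end PriorityValue

lemma sum_bernoulli_eq_outcomeMean (F : ℕ → ℕ → ℝ) {m : ℕ} (u : Fin m → ℝ) :
    ∑ s : Fin m → Bool, (∏ i, if s i then u i else 1 - u i) *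
      F (∑ i, (s i).toNat) (∑ i, (!s i).toNat) = outcomeMean F (List.ofFn u) := by
  induction m generalizing F with
  | zero => simp [outcomeMean]
  | succ m ih =>
    rw [← (Fin.consEquiv fun _ => Bool).sum_comp, Fintype.sum_prod_type]
    simp only [Fin.consEquiv_apply, Fin.prod_univ_succ, Fin.sum_univ_succ, Fin.cons_zero,
      Fin.cons_succ, Fintype.sum_bool, List.ofFn_succ, outcomeMean, ← ih, Finset.mul_sum]
    simp [mul_assoc, add_comm]

/-- The beliefs of the channels in `a`, in decreasing order. -/
noncomputable def sortedBeliefs {n : ℕ} (ω : Fin n → ℝ) (a : Finset (Fin n)) : List ℝ :=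
  (a.val.map ω).sort (· ≥ ·)

section SortedBeliefs

variable {n : ℕ} {ω : Fin n → ℝ} {a : Finset (Fin n)}

lemma coe_sortedBeliefs : (sortedBeliefs ω a : Multiset ℝ) = a.val.map ω :=
  Multiset.sort_eq _ _

lemma length_sortedBeliefs : (sortedBeliefs ω a).length = a.card := by
  simp [sortedBeliefs]

lemma mem_sortedBeliefs {z : ℝ} : z ∈ sortedBeliefs ω a ↔ ∃ i ∈ a, ω i = z := by
  simp [sortedBeliefs]

lemma pairwise_sortedBeliefs : (sortedBeliefs ω a).Pairwise (· ≥ ·) :=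
  Multiset.pairwise_sort _ _

lemma sum_sortedBeliefs : (sortedBeliefs ω a).sum = ∑ i ∈ a, ω i := by
  rw [← Multiset.sum_coe, coe_sortedBeliefs]; rfl

lemma eq_sortedBeliefs {L : List ℝ} (hL : L.Pairwise (· ≥ ·))
    (h : (L : Multiset ℝ) = a.val.map ω) : L = sortedBeliefs ω a :=
  List.Perm.eq_of_pairwise' hL pairwise_sortedBeliefs
    (Multiset.coe_eq_coe.1 (h.trans coe_sortedBeliefs.symm))

lemma val_add_val_compl (a : Finset (Fin n)) : a.val + aᶜ.val = Finset.univ.val := by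
  rw [← Finset.disjUnion_val _ _ disjoint_compl_right, Finset.disjUnion_eq_union,
    Finset.union_compl]

lemma coe_sortedBeliefs_append_compl :
    ((sortedBeliefs ω a ++ sortedBeliefs ω aᶜ : List ℝ) : Multiset ℝ) =
      Finset.univ.val.map ω := by
  rw [← Multiset.coe_add, coe_sortedBeliefs, coe_sortedBeliefs, ← Multiset.map_add,
    val_add_val_compl]

lemma sum_obsProb_eq_outcomeMean (F : ℕ → ℕ → ℝ) :
    ∑ s : {i // i ∈ a} → Bool, obsProb ω a s * F (∑ i, (s i).toNat) (∑ i, (!s i).toNat) =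
      outcomeMean F (sortedBeliefs ω a) := by
  let e := a.equivFin
  have hperm : (List.ofFn fun j => ω (e.symm j)).Perm (sortedBeliefs ω a) := by
    rw [← Multiset.coe_eq_coe, coe_sortedBeliefs, ← Multiset.attach_map_val a.val,
      Multiset.map_map]
    change _ = Multiset.map _ (Finset.univ : Finset {i // i ∈ a}).val
    rw [← Finset.map_univ_equiv e.symm, Finset.map_val, Multiset.map_map,
      List.ofFn_eq_map, ← Multiset.map_coe]
    rfl
  rw [← outcomeMean_perm hperm, ← sum_bernoulli_eq_outcomeMean,
    ← (e.arrowCongr (Equiv.refl Bool)).symm.sum_comp]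
  refine Finset.sum_congr rfl fun s _ => ?_
  rw [obsProb, ← e.symm.prod_comp, ← e.symm.sum_comp, ← e.symm.sum_comp]
  simp

lemma map_ite_eq_replicate {ι : Type*} (t : Finset ι) (s : ι → Bool) (p q : ℝ) :
    t.val.map (fun i => if s i then p else q) =
      Multiset.replicate (∑ i ∈ t, (s i).toNat) p +
        Multiset.replicate (∑ i ∈ t, (!s i).toNat) q := by
  classical
  induction t using Finset.induction_on with
  | empty => simp
  | insert i t hi ih =>
    rw [Finset.insert_val_of_notMem hi, Multiset.map_cons, ih, Finset.sum_insert hi,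
      Finset.sum_insert hi]
    cases s i <;> simp [add_comm 1, Multiset.replicate_succ]

lemma sortedBeliefs_nextState {p01 p11 : ℝ} (hord : p01 ≤ p11)
    (hω : ∀ i, ω i ∈ Set.Icc (0 : ℝ) 1) (s : {i // i ∈ a} → Bool) :
    sortedBeliefs (nextState p01 p11 ω a s) Finset.univ =
      List.replicate (∑ i, (s i).toNat) p11 ++
        ((sortedBeliefs ω aᶜ).map (tauF p01 p11) ++ List.replicate (∑ i, (!s i).toNat) p01) := by
  have hτ : ∀ z ∈ (sortedBeliefs ω aᶜ).map (tauF p01 p11), z ∈ Set.Icc p01 p11 := by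
    intro z hz
    obtain ⟨w, hw, rfl⟩ := List.mem_map.1 hz
    obtain ⟨i, -, rfl⟩ := mem_sortedBeliefs.1 hw
    exact tauF_mem_Icc hord (hω i)
  symm
  apply eq_sortedBeliefs
  · refine List.pairwise_append.2 ⟨List.pairwise_replicate.2 (.inr le_rfl),
      List.pairwise_append.2 ⟨pairwise_sortedBeliefs.map _ fun _ _ h => tauF_mono hord h,
        List.pairwise_replicate.2 (.inr le_rfl), fun x hx y hy => ?_⟩, fun x hx y hy => ?_⟩
    · exact List.eq_of_mem_replicate hy ▸ (hτ x hx).1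
    · rw [List.eq_of_mem_replicate hx]
      rcases List.mem_append.1 hy with hy | hy
      · exact (hτ y hy).2
      · exact List.eq_of_mem_replicate hy ▸ hord
  · have ha : a.val.map (nextState p01 p11 ω a s) =
        Multiset.replicate (∑ i, (s i).toNat) p11 +
          Multiset.replicate (∑ i, (!s i).toNat) p01 := by
      rw [← map_ite_eq_replicate, ← Multiset.attach_map_val a.val, Multiset.map_map]
      change Multiset.map _ (Finset.univ : Finset {i // i ∈ a}).val = _
      refine Multiset.map_congr rfl fun i _ => ?_
      simp [nextState]
    have hc : aᶜ.val.map (nextState p01 p11 ω a s) = (aᶜ.val.map ω).map (tauF p01 p11) := by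
      rw [Multiset.map_map]
      refine Multiset.map_congr rfl fun i hi => ?_
      have hi' : i ∉ a := Finset.mem_compl.1 hi
      simp [nextState, hi']
    rw [← val_add_val_compl a, Multiset.map_add, ha, hc, ← coe_sortedBeliefs, Multiset.map_coe,
      ← Multiset.coe_replicate, ← Multiset.coe_replicate, ← Multiset.coe_add,
      ← Multiset.coe_add]
    abel

lemma nextState_mem_Icc {p01 p11 : ℝ} (hp01 : p01 ∈ Set.Icc (0 : ℝ) 1)
    (hp11 : p11 ∈ Set.Icc (0 : ℝ) 1) (hord : p01 ≤ p11) (hω : ∀ i, ω i ∈ Set.Icc (0 : ℝ) 1)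
    (s : {i // i ∈ a} → Bool) (i : Fin n) : nextState p01 p11 ω a s i ∈ Set.Icc (0 : ℝ) 1 := by
  unfold nextState
  split_ifs
  · exact hp11
  · exact hp01
  · have h := tauF_mem_Icc hord (hω i)
    exact ⟨hp01.1.trans h.1, h.2.trans hp11.2⟩

/-- Playing `a` and then following the greedy policy is the same as playing the priority list that
starts with `a`. -/
lemma action_value_eq_priorityValue {k : ℕ} {p01 p11 β : ℝ} (hord : p01 ≤ p11)
    (hω : ∀ i, ω i ∈ Set.Icc (0 : ℝ) 1) (ha : a.card = k) (r : ℕ) :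
    (∑ i ∈ a, ω i) + β * ∑ s : {i // i ∈ a} → Bool, obsProb ω a s *
      priorityValue k p01 p11 β r (sortedBeliefs (nextState p01 p11 ω a s) Finset.univ) =
      priorityValue k p01 p11 β (r + 1) (sortedBeliefs ω a ++ sortedBeliefs ω aᶜ) := by
  rw [priorityValue_succ_append (length_sortedBeliefs.trans ha), sum_sortedBeliefs,
    ← sum_obsProb_eq_outcomeMean]
  simp only [sortedBeliefs_nextState hord hω]

lemma sortedBeliefs_mem_Icc (hω : ∀ i, ω i ∈ Set.Icc (0 : ℝ) 1) :
    ∀ z ∈ sortedBeliefs ω a, z ∈ Set.Icc (0 : ℝ) 1 := by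
  intro z hz
  obtain ⟨i, -, rfl⟩ := mem_sortedBeliefs.1 hz
  exact hω i

lemma priorityValue_append_compl_le {k : ℕ} {p01 p11 β : ℝ} {r : ℕ}
    (hS : SwapImproves k p01 p11 β r) (hω : ∀ i, ω i ∈ Set.Icc (0 : ℝ) 1) :
    priorityValue k p01 p11 β r (sortedBeliefs ω a ++ sortedBeliefs ω aᶜ) ≤
      priorityValue k p01 p11 β r (sortedBeliefs ω Finset.univ) := by
  have h := hS.insertionSort (R := []) (L := sortedBeliefs ω a ++ sortedBeliefs ω aᶜ) (by simp)
    (List.forall_mem_append.2 ⟨sortedBeliefs_mem_Icc hω, sortedBeliefs_mem_Icc hω⟩)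
  rwa [List.nil_append, List.nil_append, eq_sortedBeliefs (List.pairwise_insertionSort _ _)
    ((Multiset.coe_eq_coe.2 (List.perm_insertionSort _ _)).trans
      coe_sortedBeliefs_append_compl)] at h

lemma append_compl_eq_of_greedy (hg : ∀ i ∈ a, ∀ j ∉ a, ω j ≤ ω i) :
    sortedBeliefs ω a ++ sortedBeliefs ω aᶜ = sortedBeliefs ω Finset.univ := by
  refine eq_sortedBeliefs (List.pairwise_append.2
    ⟨pairwise_sortedBeliefs, pairwise_sortedBeliefs, fun x hx y hy => ?_⟩)
    coe_sortedBeliefs_append_compl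
  obtain ⟨i, hi, rfl⟩ := mem_sortedBeliefs.1 hx
  obtain ⟨j, hj, rfl⟩ := mem_sortedBeliefs.1 hy
  exact hg i hi j (Finset.mem_compl.1 hj)

lemma obsProb_nonneg (hω : ∀ i, ω i ∈ Set.Icc (0 : ℝ) 1) (s : {i // i ∈ a} → Bool) :
    0 ≤ obsProb ω a s := by
  refine Finset.prod_nonneg fun i _ => ?_
  split_ifs
  · exact (hω i).1
  · linarith [(hω i).2]

lemma sum_obsProb : ∑ s : {i // i ∈ a} → Bool, obsProb ω a s = 1 := by
  simpa [outcomeMean_const] using sum_obsProb_eq_outcomeMean (ω := ω) (a := a) fun _ _ => 1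

end SortedBeliefs

lemma exists_greedy {n k : ℕ} (hk : k ≤ n) (ω : Fin n → ℝ) :
    ∃ g ∈ actions n k, ∀ i ∈ g, ∀ j ∉ g, ω j ≤ ω i := by
  obtain ⟨g, hg, hmax⟩ := (actions n k).exists_max_image (fun a => ∑ i ∈ a, ω i)
    (actions_nonempty hk)
  refine ⟨g, hg, fun i hi j hj => ?_⟩
  have hcard : g.card = k := (Finset.mem_powersetCard.1 hg).2
  have hj' : j ∉ g.erase i := fun h => hj (Finset.mem_of_mem_erase h)
  have h := hmax (insert j (g.erase i)) (Finset.mem_powersetCard.2 ⟨Finset.subset_univ _, by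
    rw [Finset.card_insert_of_notMem hj', Finset.card_erase_add_one hi, hcard]⟩)
  simp only [Finset.sum_insert hj', ← Finset.add_sum_erase g ω hi] at h
  linarith

/-- The Bellman operator turns a pointwise bound `V ≤ V' + D` into the bound with `β * D`. -/
lemma bellman_le_add {n k : ℕ} (hkn : k ≤ n) {p01 p11 β : ℝ}
    (hp01 : p01 ∈ Set.Icc (0 : ℝ) 1) (hp11 : p11 ∈ Set.Icc (0 : ℝ) 1) (hord : p01 ≤ p11)
    (hβ0 : 0 ≤ β) {V V' : (Fin n → ℝ) → ℝ} {D : ℝ}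
    (hD : ∀ ω : Fin n → ℝ, (∀ i, ω i ∈ Set.Icc (0 : ℝ) 1) → V ω ≤ V' ω + D)
    {ω : Fin n → ℝ} (hω : ∀ i, ω i ∈ Set.Icc (0 : ℝ) 1) :
    ((actions n k).sup' (actions_nonempty hkn) fun a =>
      (∑ i ∈ a, ω i) + β * ∑ s : {i // i ∈ a} → Bool,
        obsProb ω a s * V (nextState p01 p11 ω a s)) ≤
    ((actions n k).sup' (actions_nonempty hkn) fun a =>
      (∑ i ∈ a, ω i) + β * ∑ s : {i // i ∈ a} → Bool,
        obsProb ω a s * V' (nextState p01 p11 ω a s)) + β * D := by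
  refine Finset.sup'_le _ _ fun a ha => ?_
  have hmean : ∑ s : {i // i ∈ a} → Bool, obsProb ω a s * V (nextState p01 p11 ω a s) ≤
      ∑ s : {i // i ∈ a} → Bool, obsProb ω a s * V' (nextState p01 p11 ω a s) + D := by
    calc _ ≤ ∑ s : {i // i ∈ a} → Bool, obsProb ω a s * (V' (nextState p01 p11 ω a s) + D) :=
          Finset.sum_le_sum fun s _ => mul_le_mul_of_nonneg_left
            (hD _ (nextState_mem_Icc hp01 hp11 hord hω s)) (obsProb_nonneg hω s)
      _ = _ := by simp only [mul_add, Finset.sum_add_distrib, ← Finset.sum_mul, sum_obsProb,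
          one_mul]
  have hmul := mul_le_mul_of_nonneg_left hmean hβ0
  have hle := Finset.le_sup' (fun a => (∑ i ∈ a, ω i) + β * ∑ s : {i // i ∈ a} → Bool,
    obsProb ω a s * V' (nextState p01 p11 ω a s)) ha
  linarith

lemma bellman_solution_le {n k : ℕ} (hkn : k ≤ n) {p01 p11 β : ℝ}
    (hp01 : p01 ∈ Set.Icc (0 : ℝ) 1) (hp11 : p11 ∈ Set.Icc (0 : ℝ) 1) (hord : p01 ≤ p11)
    (hβ0 : 0 ≤ β) (hβ1 : β < 1) {V V' : (Fin n → ℝ) → ℝ} {C C' : ℝ}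
    (hC : ∀ ω : Fin n → ℝ, (∀ i, ω i ∈ Set.Icc (0 : ℝ) 1) → |V ω| ≤ C)
    (hC' : ∀ ω : Fin n → ℝ, (∀ i, ω i ∈ Set.Icc (0 : ℝ) 1) → |V' ω| ≤ C')
    (hV : ∀ ω : Fin n → ℝ, (∀ i, ω i ∈ Set.Icc (0 : ℝ) 1) →
      V ω = (actions n k).sup' (actions_nonempty hkn) fun a =>
        (∑ i ∈ a, ω i) + β * ∑ s : {i // i ∈ a} → Bool,
          obsProb ω a s * V (nextState p01 p11 ω a s))
    (hV' : ∀ ω : Fin n → ℝ, (∀ i, ω i ∈ Set.Icc (0 : ℝ) 1) →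
      V' ω = (actions n k).sup' (actions_nonempty hkn) fun a =>
        (∑ i ∈ a, ω i) + β * ∑ s : {i // i ∈ a} → Bool,
          obsProb ω a s * V' (nextState p01 p11 ω a s))
    {ω : Fin n → ℝ} (hω : ∀ i, ω i ∈ Set.Icc (0 : ℝ) 1) : V ω ≤ V' ω := by
  have hpow : ∀ (m : ℕ) (ω : Fin n → ℝ), (∀ i, ω i ∈ Set.Icc (0 : ℝ) 1) →
      V ω ≤ V' ω + β ^ m * (C + C') := by
    intro m
    induction m with
    | zero =>
      intro ω hω
      linarith [(abs_le.1 (hC ω hω)).2, (abs_le.1 (hC' ω hω)).1]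
    | succ m ih =>
      intro ω hω
      rw [hV ω hω, hV' ω hω, pow_succ', mul_assoc]
      exact bellman_le_add hkn hp01 hp11 hord hβ0 ih hω
  have hlim : Filter.Tendsto (fun m : ℕ => V' ω + β ^ m * (C + C')) Filter.atTop
      (nhds (V' ω)) := by
    simpa using ((tendsto_pow_atTop_nhds_zero_of_lt_one hβ0 hβ1).mul_const (C + C')).const_add
      (V' ω)
  exact ge_of_tendsto' hlim fun m => hpow m ω hω

/-- The limit of the finite-horizon greedy values. -/
noncomputable def greedyValue {n : ℕ} (k : ℕ) (p01 p11 β : ℝ) (ω : Fin n → ℝ) : ℝ :=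
  ⨆ r, priorityValue k p01 p11 β r (sortedBeliefs ω Finset.univ)

section GreedyValue

variable {n k : ℕ} {p01 p11 β : ℝ} {ω : Fin n → ℝ}

lemma tendsto_greedyValue (hp01 : p01 ∈ Set.Icc (0 : ℝ) 1) (hp11 : p11 ∈ Set.Icc (0 : ℝ) 1)
    (hord : p01 ≤ p11) (hβ0 : 0 ≤ β) (hβ1 : β < 1) (hω : ∀ i, ω i ∈ Set.Icc (0 : ℝ) 1) :
    Filter.Tendsto (fun r => priorityValue k p01 p11 β r (sortedBeliefs ω Finset.univ))
      Filter.atTop (nhds (greedyValue k p01 p11 β ω)) := by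
  refine tendsto_atTop_ciSup (monotone_nat_of_le_succ fun r =>
    priorityValue_le_succ hp01 hp11 hord hβ0 r (sortedBeliefs_mem_Icc hω)) ⟨k / (1 - β), ?_⟩
  rintro _ ⟨r, rfl⟩
  exact priorityValue_le hp01 hp11 hord hβ0 hβ1 r (sortedBeliefs_mem_Icc hω)

lemma abs_greedyValue_le (hp01 : p01 ∈ Set.Icc (0 : ℝ) 1) (hp11 : p11 ∈ Set.Icc (0 : ℝ) 1)
    (hord : p01 ≤ p11) (hβ0 : 0 ≤ β) (hβ1 : β < 1) (hω : ∀ i, ω i ∈ Set.Icc (0 : ℝ) 1) :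
    |greedyValue k p01 p11 β ω| ≤ k / (1 - β) := by
  have hlim := tendsto_greedyValue (k := k) hp01 hp11 hord hβ0 hβ1 hω
  have hmono : Monotone fun r => priorityValue k p01 p11 β r (sortedBeliefs ω Finset.univ) :=
    monotone_nat_of_le_succ fun r =>
      priorityValue_le_succ hp01 hp11 hord hβ0 r (sortedBeliefs_mem_Icc hω)
  have h0 : 0 ≤ greedyValue k p01 p11 β ω := hmono.ge_of_tendsto hlim 0
  rw [abs_of_nonneg h0]
  exact le_of_tendsto' hlim fun r =>
    priorityValue_le hp01 hp11 hord hβ0 hβ1 r (sortedBeliefs_mem_Icc hω)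

lemma tendsto_action_value (hp01 : p01 ∈ Set.Icc (0 : ℝ) 1) (hp11 : p11 ∈ Set.Icc (0 : ℝ) 1)
    (hord : p01 ≤ p11) (hβ0 : 0 ≤ β) (hβ1 : β < 1) (hω : ∀ i, ω i ∈ Set.Icc (0 : ℝ) 1)
    {a : Finset (Fin n)} (ha : a.card = k) :
    Filter.Tendsto (fun r => priorityValue k p01 p11 β (r + 1)
        (sortedBeliefs ω a ++ sortedBeliefs ω aᶜ)) Filter.atTop
      (nhds ((∑ i ∈ a, ω i) + β * ∑ s : {i // i ∈ a} → Bool,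
        obsProb ω a s * greedyValue k p01 p11 β (nextState p01 p11 ω a s))) := by
  simp only [← action_value_eq_priorityValue hord hω ha]
  exact ((tendsto_finsetSum _ fun s _ => (tendsto_greedyValue hp01 hp11 hord hβ0 hβ1
    (nextState_mem_Icc hp01 hp11 hord hω s)).const_mul _).const_mul β).const_add _

lemma action_value_le_greedyValue (hk1 : 1 ≤ k) (hp01 : p01 ∈ Set.Icc (0 : ℝ) 1)
    (hp11 : p11 ∈ Set.Icc (0 : ℝ) 1) (hord : p01 ≤ p11) (hβ0 : 0 ≤ β) (hβ1 : β < 1)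
    (hω : ∀ i, ω i ∈ Set.Icc (0 : ℝ) 1) {a : Finset (Fin n)} (ha : a.card = k) :
    (∑ i ∈ a, ω i) + β * ∑ s : {i // i ∈ a} → Bool,
      obsProb ω a s * greedyValue k p01 p11 β (nextState p01 p11 ω a s) ≤
      greedyValue k p01 p11 β ω :=
  le_of_tendsto_of_tendsto' (tendsto_action_value hp01 hp11 hord hβ0 hβ1 hω ha)
    ((Filter.tendsto_add_atTop_iff_nat 1).2 (tendsto_greedyValue hp01 hp11 hord hβ0 hβ1 hω))
    fun r => priorityValue_append_compl_le
      (swapImproves_and_rotationBound hk1 hp01 hp11 hord hβ0 hβ1.le (r + 1)).1 hω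

lemma greedyValue_eq_action_value (hp01 : p01 ∈ Set.Icc (0 : ℝ) 1)
    (hp11 : p11 ∈ Set.Icc (0 : ℝ) 1) (hord : p01 ≤ p11) (hβ0 : 0 ≤ β) (hβ1 : β < 1)
    (hω : ∀ i, ω i ∈ Set.Icc (0 : ℝ) 1) {g : Finset (Fin n)} (hg : g.card = k)
    (hgreedy : ∀ i ∈ g, ∀ j ∉ g, ω j ≤ ω i) :
    greedyValue k p01 p11 β ω = (∑ i ∈ g, ω i) + β * ∑ s : {i // i ∈ g} → Bool,
      obsProb ω g s * greedyValue k p01 p11 β (nextState p01 p11 ω g s) := by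
  have h := tendsto_action_value hp01 hp11 hord hβ0 hβ1 hω hg
  rw [append_compl_eq_of_greedy hgreedy] at h
  exact tendsto_nhds_unique
    ((Filter.tendsto_add_atTop_iff_nat 1).2 (tendsto_greedyValue hp01 hp11 hord hβ0 hβ1 hω)) h

lemma greedyValue_bellman (hk1 : 1 ≤ k) (hkn : k ≤ n) (hp01 : p01 ∈ Set.Icc (0 : ℝ) 1)
    (hp11 : p11 ∈ Set.Icc (0 : ℝ) 1) (hord : p01 ≤ p11) (hβ0 : 0 ≤ β) (hβ1 : β < 1)
    (hω : ∀ i, ω i ∈ Set.Icc (0 : ℝ) 1) :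
    greedyValue k p01 p11 β ω = (actions n k).sup' (actions_nonempty hkn) fun a =>
      (∑ i ∈ a, ω i) + β * ∑ s : {i // i ∈ a} → Bool,
        obsProb ω a s * greedyValue k p01 p11 β (nextState p01 p11 ω a s) := by
  apply le_antisymm
  · obtain ⟨g, hg, hgreedy⟩ := exists_greedy hkn ω
    rw [greedyValue_eq_action_value hp01 hp11 hord hβ0 hβ1 hω
      (Finset.mem_powersetCard.1 hg).2 hgreedy]
    exact Finset.le_sup' (fun a => (∑ i ∈ a, ω i) + β * ∑ s : {i // i ∈ a} → Bool,
      obsProb ω a s * greedyValue k p01 p11 β (nextState p01 p11 ω a s)) hg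
  · exact Finset.sup'_le _ _ fun a ha =>
      action_value_le_greedyValue hk1 hp01 hp11 hord hβ0 hβ1 hω (Finset.mem_powersetCard.1 ha).2

end GreedyValue

/-- infinite-horizon discounted problem.  Under `p01 ≤ p11` and
`β ∈ [0,1)`, there is a unique bounded function `V` on `[0,1]^n` satisfying the
Bellman equation, and any greedy set achieves the maximum in the Bellman
equation: the greedy policy is optimal for the infinite-horizon problem. -/
theorem greedy_optimal_infinite_horizon
    (n k : ℕ) (hk1 : 1 ≤ k) (hkn : k ≤ n)
    (p01 p11 β : ℝ)
    (hp01 : p01 ∈ Set.Icc (0:ℝ) 1) (hp11 : p11 ∈ Set.Icc (0:ℝ) 1)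
    (hβ0 : 0 ≤ β) (hβ1 : β < 1) (hord : p01 ≤ p11) :
    ∃ V : (Fin n → ℝ) → ℝ,
      ((∃ C : ℝ, ∀ ω : Fin n → ℝ, (∀ i, ω i ∈ Set.Icc (0:ℝ) 1) → |V ω| ≤ C) ∧
        (∀ ω : Fin n → ℝ, (∀ i, ω i ∈ Set.Icc (0:ℝ) 1) →
          V ω = (actions n k).sup' (actions_nonempty hkn) fun a =>
            (∑ i ∈ a, ω i) +
              β * ∑ s : {i // i ∈ a} → Bool,
                obsProb ω a s * V (nextState p01 p11 ω a s))) ∧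
      (∀ V' : (Fin n → ℝ) → ℝ,
        (∃ C : ℝ, ∀ ω : Fin n → ℝ, (∀ i, ω i ∈ Set.Icc (0:ℝ) 1) → |V' ω| ≤ C) →
        (∀ ω : Fin n → ℝ, (∀ i, ω i ∈ Set.Icc (0:ℝ) 1) →
          V' ω = (actions n k).sup' (actions_nonempty hkn) fun a =>
            (∑ i ∈ a, ω i) +
              β * ∑ s : {i // i ∈ a} → Bool,
                obsProb ω a s * V' (nextState p01 p11 ω a s)) →
        ∀ ω : Fin n → ℝ, (∀ i, ω i ∈ Set.Icc (0:ℝ) 1) → V' ω = V ω) ∧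
      (∀ ω : Fin n → ℝ, (∀ i, ω i ∈ Set.Icc (0:ℝ) 1) →
        ∀ g ∈ actions n k, (∀ i ∈ g, ∀ j ∉ g, ω j ≤ ω i) →
          V ω = (∑ i ∈ g, ω i) +
            β * ∑ s : {i // i ∈ g} → Bool,
              obsProb ω g s * V (nextState p01 p11 ω g s)) := by
  refine ⟨greedyValue k p01 p11 β, ⟨⟨k / (1 - β), fun ω hω =>
    abs_greedyValue_le hp01 hp11 hord hβ0 hβ1 hω⟩, fun ω hω =>
    greedyValue_bellman hk1 hkn hp01 hp11 hord hβ0 hβ1 hω⟩, ?_, ?_⟩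
  · rintro V' ⟨C, hC⟩ hV' ω hω
    exact le_antisymm
      (bellman_solution_le hkn hp01 hp11 hord hβ0 hβ1 hC
        (fun ω hω => abs_greedyValue_le hp01 hp11 hord hβ0 hβ1 hω) hV'
        (fun ω hω => greedyValue_bellman hk1 hkn hp01 hp11 hord hβ0 hβ1 hω) hω)
      (bellman_solution_le hkn hp01 hp11 hord hβ0 hβ1
        (fun ω hω => abs_greedyValue_le hp01 hp11 hord hβ0 hβ1 hω) hC
        (fun ω hω => greedyValue_bellman hk1 hkn hp01 hp11 hord hβ0 hβ1 hω) hV' hω)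
  · exact fun ω hω g hg hgreedy => greedyValue_eq_action_value hp01 hp11 hord hβ0 hβ1 hω
      (Finset.mem_powersetCard.1 hg).2 hgreedy
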